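/- For every r ∈ [0,R] there holds the identity ∫₀^{s(r)} (1 + q·β(r,z))·|v_r(r,z)|² dz = q·α²·∫₀^{s(r)} |v_{rz}(r,z)|² dz + i·α²·λ·∫₀^{s(r)} [ (β(r,z)/α²)·v(r,z) + v_{zz}(r,z) ]·conj(v_r(r,z)) dz − q·α²·v_{rz}(r,s(r))·conj(v_r(r,s(r))). -/

import Mathlib

open Complex Set MeasureTheory intervalIntegral

/-- Partial derivative in the first (range) variable. -/
noncomputable def pr (f : ℝ → ℝ → ℂ) (r z : ℝ) : ℂ := deriv (fun t => f t z) r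

/-- Partial derivative in the second (depth) variable. -/
noncomputable def pz (f : ℝ → ℝ → ℂ) (r z : ℝ) : ℂ := deriv (fun w => f r w) z

/-- The waveguide domain `𝒟 = {(r,z) : 0 ≤ r ≤ R, 0 ≤ z ≤ s(r)}`. -/
def wgDom (R : ℝ) (s : ℝ → ℝ) : Set (ℝ × ℝ) :=
  {p : ℝ × ℝ | p.1 ∈ Icc 0 R ∧ p.2 ∈ Icc 0 (s p.1)}

/-- Smoothness on an open neighborhood of the domain `𝒟`. -/
def SmoothNearDom (R : ℝ) (s : ℝ → ℝ) (f : ℝ → ℝ → ℂ) : Prop :=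
  ∃ U : Set (ℝ × ℝ), IsOpen U ∧ wgDom R s ⊆ U ∧
    ContDiffOn ℝ (⊤ : ℕ∞) (fun p : ℝ × ℝ => f p.1 p.2) U

lemma hasDerivAt_prodMk_fst {F : ℝ × ℝ → ℂ} {p : ℝ × ℝ} (hF : DifferentiableAt ℝ F p) :
    HasDerivAt (fun t => F (t, p.2)) (fderiv ℝ F p (1, 0)) p.1 := by
  have hline : HasDerivAt (fun t : ℝ => (t, p.2)) ((1 : ℝ), (0 : ℝ)) p.1 :=
    (hasDerivAt_id p.1).prodMk (hasDerivAt_const p.1 p.2)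
  exact HasFDerivAt.comp_hasDerivAt p.1 (f := fun t : ℝ => (t, p.2)) (l := F)
    hF.hasFDerivAt hline

lemma hasDerivAt_prodMk_snd {F : ℝ × ℝ → ℂ} {p : ℝ × ℝ} (hF : DifferentiableAt ℝ F p) :
    HasDerivAt (fun w => F (p.1, w)) (fderiv ℝ F p (0, 1)) p.2 := by
  have hline : HasDerivAt (fun w : ℝ => (p.1, w)) ((0 : ℝ), (1 : ℝ)) p.2 :=
    (hasDerivAt_const p.2 p.1).prodMk (hasDerivAt_id p.2)
  exact HasFDerivAt.comp_hasDerivAt p.2 (f := fun w : ℝ => (p.1, w)) (l := F)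
    hF.hasFDerivAt hline

section PartialDerivatives

variable {U : Set (ℝ × ℝ)} {f : ℝ → ℝ → ℂ}

lemma differentiableAt_of_contDiffOn_open (hU : IsOpen U)
    (hf : ContDiffOn ℝ (⊤ : ℕ∞) (fun p : ℝ × ℝ => f p.1 p.2) U) {p : ℝ × ℝ} (hp : p ∈ U) :
    DifferentiableAt ℝ (fun p : ℝ × ℝ => f p.1 p.2) p :=
  (hf.contDiffAt (hU.mem_nhds hp)).differentiableAt (by simp)

lemma pr_eq_fderiv (hU : IsOpen U)
    (hf : ContDiffOn ℝ (⊤ : ℕ∞) (fun p : ℝ × ℝ => f p.1 p.2) U) {p : ℝ × ℝ} (hp : p ∈ U) :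
    pr f p.1 p.2 = fderiv ℝ (fun p : ℝ × ℝ => f p.1 p.2) p (1, 0) :=
  (hasDerivAt_prodMk_fst (differentiableAt_of_contDiffOn_open hU hf hp)).deriv

lemma pz_eq_fderiv (hU : IsOpen U)
    (hf : ContDiffOn ℝ (⊤ : ℕ∞) (fun p : ℝ × ℝ => f p.1 p.2) U) {p : ℝ × ℝ} (hp : p ∈ U) :
    pz f p.1 p.2 = fderiv ℝ (fun p : ℝ × ℝ => f p.1 p.2) p (0, 1) :=
  (hasDerivAt_prodMk_snd (differentiableAt_of_contDiffOn_open hU hf hp)).deriv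

lemma contDiffOn_pr (hU : IsOpen U)
    (hf : ContDiffOn ℝ (⊤ : ℕ∞) (fun p : ℝ × ℝ => f p.1 p.2) U) :
    ContDiffOn ℝ (⊤ : ℕ∞) (fun p : ℝ × ℝ => pr f p.1 p.2) U :=
  ((hf.fderiv_of_isOpen hU (m := (⊤ : ℕ∞)) (by simp)).clm_apply contDiffOn_const).congr
    fun _ hp => pr_eq_fderiv hU hf hp

lemma contDiffOn_pz (hU : IsOpen U)
    (hf : ContDiffOn ℝ (⊤ : ℕ∞) (fun p : ℝ × ℝ => f p.1 p.2) U) :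
    ContDiffOn ℝ (⊤ : ℕ∞) (fun p : ℝ × ℝ => pz f p.1 p.2) U :=
  ((hf.fderiv_of_isOpen hU (m := (⊤ : ℕ∞)) (by simp)).clm_apply contDiffOn_const).congr
    fun _ hp => pz_eq_fderiv hU hf hp

lemma hasDerivAt_pz (hU : IsOpen U)
    (hf : ContDiffOn ℝ (⊤ : ℕ∞) (fun p : ℝ × ℝ => f p.1 p.2) U) {p : ℝ × ℝ} (hp : p ∈ U) :
    HasDerivAt (fun w => f p.1 w) (pz f p.1 p.2) p.2 :=
  pz_eq_fderiv hU hf hp ▸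
    hasDerivAt_prodMk_snd (differentiableAt_of_contDiffOn_open hU hf hp)

lemma hasDerivAt_pr (hU : IsOpen U)
    (hf : ContDiffOn ℝ (⊤ : ℕ∞) (fun p : ℝ × ℝ => f p.1 p.2) U) {p : ℝ × ℝ} (hp : p ∈ U) :
    HasDerivAt (fun t => f t p.2) (pr f p.1 p.2) p.1 :=
  pr_eq_fderiv hU hf hp ▸
    hasDerivAt_prodMk_fst (differentiableAt_of_contDiffOn_open hU hf hp)

lemma pz_congr_of_eqOn_open {g : ℝ → ℝ → ℂ} (hU : IsOpen U)
    (h : ∀ p ∈ U, f p.1 p.2 = g p.1 p.2) {p : ℝ × ℝ} (hp : p ∈ U) :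
    pz f p.1 p.2 = pz g p.1 p.2 := by
  refine Filter.EventuallyEq.deriv_eq ?_
  have hcont : ContinuousAt (fun w : ℝ => (p.1, w)) p.2 := by fun_prop
  filter_upwards [hcont.preimage_mem_nhds (hU.mem_nhds hp)] with w hw using h _ hw

lemma pr_pz_eq_pz_pr (hU : IsOpen U)
    (hf : ContDiffOn ℝ (⊤ : ℕ∞) (fun p : ℝ × ℝ => f p.1 p.2) U) {p : ℝ × ℝ} (hp : p ∈ U) :
    pr (pz f) p.1 p.2 = pz (pr f) p.1 p.2 := by
  have hdiff : DifferentiableAt ℝ (fderiv ℝ fun p : ℝ × ℝ => f p.1 p.2) p :=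
    ((hf.fderiv_of_isOpen hU (m := (⊤ : ℕ∞)) (by simp)).contDiffAt
      (hU.mem_nhds hp)).differentiableAt (by simp)
  have hsymm : IsSymmSndFDerivAt ℝ (fun p : ℝ × ℝ => f p.1 p.2) p :=
    (hf.contDiffAt (hU.mem_nhds hp)).isSymmSndFDerivAt
      (by simpa using WithTop.coe_le_coe.2 (le_top : (2 : ℕ∞) ≤ ⊤))
  have key : ∀ (g : ℝ → ℝ → ℂ) (a b : ℝ × ℝ),
      (∀ y ∈ U, g y.1 y.2 = fderiv ℝ (fun p : ℝ × ℝ => f p.1 p.2) y a) →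
      fderiv ℝ (fun p : ℝ × ℝ => g p.1 p.2) p b
        = fderiv ℝ (fderiv ℝ fun p : ℝ × ℝ => f p.1 p.2) p b a := by
    intro g a b h
    have heq : (fun p : ℝ × ℝ => g p.1 p.2) =ᶠ[nhds p]
        fun y => fderiv ℝ (fun p : ℝ × ℝ => f p.1 p.2) y a := by
      filter_upwards [hU.mem_nhds hp] with y hy using h y hy
    rw [heq.fderiv_eq, (hdiff.hasFDerivAt.clm_apply (hasFDerivAt_const a p)).fderiv]
    simp
  rw [pr_eq_fderiv hU (contDiffOn_pz hU hf) hp, pz_eq_fderiv hU (contDiffOn_pr hU hf) hp,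
    key _ _ _ fun y hy => pz_eq_fderiv hU hf hy, key _ _ _ fun y hy => pr_eq_fderiv hU hf hy,
    hsymm]

lemma pr_pz_pz_eq_pz_pz_pr (hU : IsOpen U)
    (hf : ContDiffOn ℝ (⊤ : ℕ∞) (fun p : ℝ × ℝ => f p.1 p.2) U) {p : ℝ × ℝ} (hp : p ∈ U) :
    pr (pz (pz f)) p.1 p.2 = pz (pz (pr f)) p.1 p.2 := by
  rw [pr_pz_eq_pz_pr hU (contDiffOn_pz hU hf) hp]
  exact pz_congr_of_eqOn_open hU (fun _ hy => pr_pz_eq_pz_pr hU hf hy) hp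

lemma continuousOn_slice (hf : ContDiffOn ℝ (⊤ : ℕ∞) (fun p : ℝ × ℝ => f p.1 p.2) U)
    {r : ℝ} {t : Set ℝ} (ht : ∀ z ∈ t, (r, z) ∈ U) : ContinuousOn (fun z => f r z) t :=
  hf.continuousOn.comp (f := fun z : ℝ => (r, z)) (by fun_prop) ht

end PartialDerivatives

/-- Integration by parts of `u'' * conj u` for a function vanishing at the left endpoint. -/
lemma integral_deriv2_mul_conj {u u' u'' : ℝ → ℂ} {a : ℝ} (ha : 0 ≤ a)
    (hu : ∀ z ∈ Icc 0 a, HasDerivAt u (u' z) z) (hu' : ∀ z ∈ Icc 0 a, HasDerivAt u' (u'' z) z)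
    (hc : ContinuousOn u'' (Icc 0 a)) (h0 : u 0 = 0) :
    (∫ z in (0:ℝ)..a, u'' z * (starRingEnd ℂ) (u z))
      = u' a * (starRingEnd ℂ) (u a) - ∫ z in (0:ℝ)..a, (‖u' z‖ ^ 2 : ℂ) := by
  rw [← uIcc_of_le ha] at hu hu' hc
  have hc' : ContinuousOn u' (uIcc 0 a) := fun z hz => (hu' z hz).continuousAt.continuousWithinAt
  have hconj : ∀ z ∈ uIcc 0 a,
      HasDerivAt (fun z => (starRingEnd ℂ) (u z)) ((starRingEnd ℂ) (u' z)) z :=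
    fun z hz => (hu z hz).star
  have h := integral_deriv_mul_eq_sub hu' hconj hc.intervalIntegrable
    (Complex.continuous_conj.comp_continuousOn hc').intervalIntegrable
  have hi1 : IntervalIntegrable (fun z => u'' z * (starRingEnd ℂ) (u z)) volume 0 a :=
    (hc.mul fun z hz => (hconj z hz).continuousAt.continuousWithinAt).intervalIntegrable
  have hi2 : IntervalIntegrable (fun z => u' z * (starRingEnd ℂ) (u' z)) volume 0 a :=
    (hc'.mul (Complex.continuous_conj.comp_continuousOn hc')).intervalIntegrable
  rw [integral_add hi1 hi2] at h
  simp only [Complex.mul_conj'] at h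
  rw [h0, map_zero, mul_zero, sub_zero] at h
  exact eq_sub_of_add_eq h

lemma pr_eq_zero_of_eqOn_zero {R r z : ℝ} {f : ℝ → ℝ → ℂ} (hR : 0 < R) (hr : r ∈ Icc 0 R)
    (hf : DifferentiableAt ℝ (fun t => f t z) r) (h0 : ∀ t ∈ Icc 0 R, f t z = 0) :
    pr f r z = 0 := by
  have huniq := uniqueDiffOn_Icc hR r hr
  rw [pr, ← hf.derivWithin huniq, derivWithin_congr (f := fun _ => (0 : ℂ)) h0 (h0 r hr)]
  simp

/-- Identity (2.5): for each `r ∈ [0,R]`,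
`∫₀^{s(r)} (1+qβ)|v_r|² dz = qα² ∫₀^{s(r)} |v_rz|² dz
 + iα²λ ∫₀^{s(r)} [(β/α²) v + v_zz] conj v_r dz - qα² v_rz(r,s(r)) conj v_r(r,s(r))`. -/
theorem stmt_3 (R α : ℝ) (q : ℂ) (lam : ℝ) (s : ℝ → ℝ) (β v : ℝ → ℝ → ℂ)
    (hR : 0 < R) (hα : 0 < α) (hq : q ≠ 0) (hlam : lam ≠ 0)
    (hs : ContDiff ℝ 1 s) (hspos : ∀ r ∈ Icc (0:ℝ) R, 0 < s r)
    (hβ : SmoothNearDom R s β) (hv : SmoothNearDom R s v)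
    (hpde : ∀ r ∈ Icc (0:ℝ) R, ∀ z ∈ Icc (0:ℝ) (s r),
      (1 + q * β r z) * pr v r z + (α : ℂ) ^ 2 * q * pr (pz (pz v)) r z
        = Complex.I * (lam : ℂ) * ((α : ℂ) ^ 2 * pz (pz v) r z + β r z * v r z))
    (hsurf : ∀ r ∈ Icc (0:ℝ) R, v r 0 = 0) :
    ∀ r ∈ Icc (0:ℝ) R,
      (∫ z in (0:ℝ)..(s r), (1 + q * β r z) * (‖pr v r z‖ ^ 2 : ℂ))
        = q * (α : ℂ) ^ 2 * (∫ z in (0:ℝ)..(s r), (‖pz (pr v) r z‖ ^ 2 : ℂ))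
          + Complex.I * (α : ℂ) ^ 2 * (lam : ℂ) *
              (∫ z in (0:ℝ)..(s r),
                ((β r z / (α : ℂ) ^ 2) * v r z + pz (pz v) r z)
                  * (starRingEnd ℂ) (pr v r z))
          - q * (α : ℂ) ^ 2 * pz (pr v) r (s r) * (starRingEnd ℂ) (pr v r (s r)) := by
  intro r hr
  obtain ⟨U, hU, hDU, hvU⟩ := hv
  obtain ⟨V, _, hDV, hβV⟩ := hβ
  have hα' : (α : ℂ) ≠ 0 := by exact_mod_cast hα.ne'
  have hspos' := (hspos r hr).le
  have hmemU : ∀ z ∈ Icc 0 (s r), (r, z) ∈ U := fun z hz => hDU ⟨hr, hz⟩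
  have hmemV : ∀ z ∈ Icc 0 (s r), (r, z) ∈ V := fun z hz => hDV ⟨hr, hz⟩
  have hprU := contDiffOn_pr hU hvU
  have hrzU := contDiffOn_pz hU hprU
  have hrzzU := contDiffOn_pz hU hrzU
  have cβ := continuousOn_slice hβV hmemV
  have cv := continuousOn_slice hvU hmemU
  have cvzz := continuousOn_slice (contDiffOn_pz hU (contDiffOn_pz hU hvU)) hmemU
  have cpr := continuousOn_slice hprU hmemU
  have crzz := continuousOn_slice hrzzU hmemU
  have cconj : ContinuousOn (fun z => (starRingEnd ℂ) (pr v r z)) (Icc 0 (s r)) :=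
    Complex.continuous_conj.comp_continuousOn cpr
  have h0 : pr v r 0 = 0 :=
    pr_eq_zero_of_eqOn_zero hR hr
      (hasDerivAt_pr hU hvU (hmemU 0 (left_mem_Icc.2 hspos'))).differentiableAt hsurf
  have hparts := integral_deriv2_mul_conj hspos'
    (fun z hz => hasDerivAt_pz hU hprU (hmemU z hz))
    (fun z hz => hasDerivAt_pz hU hrzU (hmemU z hz)) crzz h0
  have hpt : ∀ z ∈ uIcc 0 (s r), (1 + q * β r z) * (‖pr v r z‖ ^ 2 : ℂ)
      = Complex.I * (α : ℂ) ^ 2 * (lam : ℂ) *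
          (((β r z / (α : ℂ) ^ 2) * v r z + pz (pz v) r z) * (starRingEnd ℂ) (pr v r z))
        - q * (α : ℂ) ^ 2 * (pz (pz (pr v)) r z * (starRingEnd ℂ) (pr v r z)) := by
    intro z hz
    rw [uIcc_of_le hspos'] at hz
    have e := hpde r hr z hz
    have hcomm := pr_pz_pz_eq_pz_pz_pr hU hvU (hmemU z hz)
    dsimp only at hcomm
    rw [hcomm] at e
    rw [← Complex.mul_conj']
    field_simp
    linear_combination (starRingEnd ℂ) (pr v r z) * e
  have hi1 : IntervalIntegrable (fun z =>
      ((β r z / (α : ℂ) ^ 2) * v r z + pz (pz v) r z) * (starRingEnd ℂ) (pr v r z))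
      volume 0 (s r) := by
    refine ContinuousOn.intervalIntegrable ?_
    rw [uIcc_of_le hspos']
    exact (((cβ.div_const _).mul cv).add cvzz).mul cconj
  have hi2 : IntervalIntegrable (fun z => pz (pz (pr v)) r z * (starRingEnd ℂ) (pr v r z))
      volume 0 (s r) := by
    refine ContinuousOn.intervalIntegrable ?_
    rw [uIcc_of_le hspos']
    exact crzz.mul cconj
  rw [integral_congr hpt, integral_sub (hi1.const_mul _) (hi2.const_mul _),
    intervalIntegral.integral_const_mul, intervalIntegral.integral_const_mul, hparts]
  ring
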